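/- arXiv:2401.12450 — 6 statements merged into one kernel-verified Lean document; each statement's English description precedes it below -/
import Mathlib

section
/- Let G be a finite group. Then the following three statements are equivalent: (1) the Chermak–Delgado measure m_G is increasing on the full subgroup lattice of G, i.e., for all subgroups H ≤ K of G one has m_G(H) ≤ m_G(K); (2) m_G(H) = m_G(H ∩ Z(G)) for every subgroup H of G; (3) the Chermak–Delgado lattice CD(G) equals the interval [G/Z(G)], i.e., a subgroup H of G belongs to CD(G) if and only if Z(G) ≤ H. -/
/-- The Chermak–Delgado measure of a subgroup `H` of `G`: `|H| * |C_G(H)|`. -/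
noncomputable def cdMeasure (G : Type*) [Group G] (H : Subgroup G) : ℕ :=
  Nat.card H * Nat.card (Subgroup.centralizer (H : Set G))

/-- The Chermak–Delgado lattice of `G`: subgroups of maximal Chermak–Delgado measure. -/
def cdLattice (G : Type*) [Group G] : Set (Subgroup G) :=
  {H | ∀ K : Subgroup G, cdMeasure G K ≤ cdMeasure G H}

/-- The centralizer lattice of `G`: subgroups that are centralizers of subgroups. -/
def centLattice (G : Type*) [Group G] : Set (Subgroup G) :=
  {C | ∃ H : Subgroup G, C = Subgroup.centralizer (H : Set G)}

namespace Subgroup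

theorem card_sup_mul_card_inf {G : Type*} [Group G] (H N : Subgroup G) [N.Normal] :
    Nat.card (H ⊔ N : Subgroup G) * Nat.card (H ⊓ N : Subgroup G) = Nat.card H * Nat.card N := by
  have h₁ : Nat.card N * N.relIndex (H ⊔ N) = Nat.card (H ⊔ N : Subgroup G) :=
    by simpa only [relIndex_bot_left] using relIndex_mul_relIndex ⊥ N (H ⊔ N) bot_le le_sup_right
  have h₂ : Nat.card (H ⊓ N : Subgroup G) * (H ⊓ N).relIndex H = Nat.card H :=
    by simpa only [relIndex_bot_left] using relIndex_mul_relIndex ⊥ (H ⊓ N) H bot_le inf_le_left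
  rw [relIndex_sup_right] at h₁
  rw [inf_relIndex_left] at h₂
  rw [← h₁, ← h₂]
  ring

theorem centralizer_sup_center {G : Type*} [Group G] (H : Subgroup G) :
    centralizer ((H ⊔ center G : Subgroup G) : Set G) = centralizer (H : Set G) := by
  refine le_antisymm (centralizer_le (SetLike.coe_subset_coe.2 le_sup_left)) ?_
  rw [le_centralizer_iff]
  exact sup_le (le_centralizer_iff.1 le_rfl) (center_le_centralizer _)

end Subgroup

theorem cdMeasure_of_le_center {G : Type*} [Group G] {H : Subgroup G}
    (h : H ≤ Subgroup.center G) : cdMeasure G H = Nat.card H * Nat.card G := by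
  rw [cdMeasure, Subgroup.centralizer_eq_top_iff_subset.2 h, Subgroup.card_top]

theorem cdMeasure_top (G : Type*) [Group G] :
    cdMeasure G ⊤ = Nat.card (Subgroup.center G) * Nat.card G := by
  rw [cdMeasure, Subgroup.coe_top, Subgroup.centralizer_univ, Subgroup.card_top, mul_comm]

theorem cdMeasure_sup_center_mul {G : Type*} [Group G] (H : Subgroup G) :
    cdMeasure G (H ⊔ Subgroup.center G) * Nat.card (H ⊓ Subgroup.center G : Subgroup G) =
      cdMeasure G H * Nat.card (Subgroup.center G) := by
  rw [cdMeasure, cdMeasure, Subgroup.centralizer_sup_center, mul_right_comm,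
    Subgroup.card_sup_mul_card_inf, mul_right_comm]

theorem cd_measure_increasing_tfae (G : Type*) [Group G] [Finite G] :
    List.TFAE
      [ ∀ H K : Subgroup G, H ≤ K → cdMeasure G H ≤ cdMeasure G K,
        ∀ H : Subgroup G, cdMeasure G H = cdMeasure G (H ⊓ Subgroup.center G),
        cdLattice G = {H : Subgroup G | Subgroup.center G ≤ H} ] := by
  have inf_center (H : Subgroup G) := cdMeasure_of_le_center (inf_le_right : H ⊓ .center G ≤ _)
  have center_pos : 0 < Nat.card (Subgroup.center G) := Nat.card_pos
  tfae_have 1 → 2 := fun h H => by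
    refine le_antisymm ?_ (h _ _ inf_le_left)
    refine Nat.le_of_mul_le_mul_right ?_ center_pos
    rw [← cdMeasure_sup_center_mul, inf_center, mul_assoc, mul_comm (Nat.card G), mul_comm,
      ← cdMeasure_top]
    exact Nat.mul_le_mul_left _ (h _ _ le_top)
  tfae_have 2 → 1 := fun h H K hHK => by
    rw [h H, h K, inf_center, inf_center]
    exact Nat.mul_le_mul_right _ (Subgroup.card_le_of_le (inf_le_inf_right _ hHK))
  tfae_have 2 → 3 := fun h => by
    ext H
    simp only [cdLattice, Set.mem_ofPred_eq]
    constructor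
    · intro hH
      have h₁ := hH ⊤
      rw [cdMeasure_top, h H, inf_center] at h₁
      exact inf_eq_right.1 (Subgroup.eq_of_le_of_card_ge inf_le_right
        (Nat.le_of_mul_le_mul_right h₁ Nat.card_pos))
    · intro hH K
      rw [h H, h K, inf_center, inf_center, inf_eq_right.2 hH]
      exact Nat.mul_le_mul_right _ (Subgroup.card_le_of_le inf_le_right)
  tfae_have 3 → 2 := fun h H => by
    have h_sup : H ⊔ .center G ∈ cdLattice G := by
      rw [h]
      exact le_sup_right (a := H)
    have h_top : ⊤ ∈ cdLattice G := by
      rw [h]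
      exact le_top (a := Subgroup.center G)
    have h₁ := cdMeasure_sup_center_mul H
    rw [le_antisymm (h_top _) (h_sup _), cdMeasure_top] at h₁
    refine Nat.eq_of_mul_eq_mul_right center_pos ?_
    rw [← h₁, inf_center]
    ring
  tfae_finish
end

section
/- Let G be a finite group. Then the Chermak–Delgado measure m_G is increasing on the centralizer lattice C(G) (i.e., for all C, D ∈ C(G) with C ≤ D one has m_G(C) ≤ m_G(D)) if and only if C(G) = CD(G). -/
theorem centralizer_centralizer_centralizer {G : Type*} [Group G] (H : Subgroup G) :
    Subgroup.centralizer (Subgroup.centralizer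
      (Subgroup.centralizer (H : Set G) : Set G) : Set G) = Subgroup.centralizer (H : Set G) :=
  SetLike.coe_injective (Set.centralizer_centralizer_centralizer (H : Set G))

theorem centralizer_centralizer_of_mem_centLattice {G : Type*} [Group G] {C : Subgroup G}
    (hC : C ∈ centLattice G) :
    Subgroup.centralizer (Subgroup.centralizer (C : Set G) : Set G) = C := by
  obtain ⟨H, rfl⟩ := hC
  exact centralizer_centralizer_centralizer H

theorem cdMeasure_centralizer_of_mem_centLattice {G : Type*} [Group G] {C : Subgroup G}
    (hC : C ∈ centLattice G) :
    cdMeasure G (Subgroup.centralizer (C : Set G)) = cdMeasure G C := by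
  rw [cdMeasure, cdMeasure, centralizer_centralizer_of_mem_centLattice hC, mul_comm]

theorem le_centralizer_centralizer {G : Type*} [Group G] (H : Subgroup G) :
    H ≤ Subgroup.centralizer (Subgroup.centralizer (H : Set G) : Set G) :=
  Set.subset_centralizer_centralizer

theorem cdMeasure_le_cdMeasure_centralizer {G : Type*} [Group G] [Finite G] (H : Subgroup G) :
    cdMeasure G H ≤ cdMeasure G (Subgroup.centralizer (H : Set G)) := by
  rw [cdMeasure, cdMeasure, mul_comm]
  exact Nat.mul_le_mul_left _ (Subgroup.card_le_of_le (le_centralizer_centralizer H))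

theorem cdLattice_subset_centLattice (G : Type*) [Group G] [Finite G] :
    cdLattice G ⊆ centLattice G := by
  intro H hH
  have h := hH (Subgroup.centralizer (H : Set G))
  rw [cdMeasure, cdMeasure, mul_comm (Nat.card H)] at h
  exact ⟨_, Subgroup.eq_of_le_of_card_ge (le_centralizer_centralizer H)
    (Nat.le_of_mul_le_mul_left h Nat.card_pos)⟩

/-- If the measure is increasing on centralizers, it is also decreasing, by duality. -/
theorem cdMeasure_eq_of_le_of_increasing {G : Type*} [Group G]
    (h : ∀ C D : Subgroup G, C ∈ centLattice G → D ∈ centLattice G → C ≤ D →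
      cdMeasure G C ≤ cdMeasure G D)
    {C D : Subgroup G} (hC : C ∈ centLattice G) (hD : D ∈ centLattice G) (hCD : C ≤ D) :
    cdMeasure G C = cdMeasure G D := by
  refine (h C D hC hD hCD).antisymm ?_
  rw [← cdMeasure_centralizer_of_mem_centLattice hC, ← cdMeasure_centralizer_of_mem_centLattice hD]
  exact h _ _ ⟨D, rfl⟩ ⟨C, rfl⟩ (Subgroup.centralizer_le hCD)

theorem top_mem_centLattice (G : Type*) [Group G] : (⊤ : Subgroup G) ∈ centLattice G :=
  ⟨⊥, by simp [eq_comm, Subgroup.centralizer_eq_top_iff_subset]⟩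

theorem cd_measure_increasing_on_centralizers_iff (G : Type*) [Group G] [Finite G] :
    (∀ C D : Subgroup G, C ∈ centLattice G → D ∈ centLattice G → C ≤ D →
        cdMeasure G C ≤ cdMeasure G D) ↔
      centLattice G = cdLattice G := by
  constructor
  · intro h
    refine Set.Subset.antisymm (fun C hC K => ?_) (cdLattice_subset_centLattice G)
    refine (cdMeasure_le_cdMeasure_centralizer K).trans_eq ?_
    rw [cdMeasure_eq_of_le_of_increasing h ⟨K, rfl⟩ (top_mem_centLattice G) le_top,
      cdMeasure_eq_of_le_of_increasing h hC (top_mem_centLattice G) le_top]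
  · intro h C D _ hD _
    rw [h] at hD
    exact hD C
end

section
/- Let G be a finite group and let P be a set of subgroups of G such that Z(G) ∈ P, G ∈ P, and P ∩ CD(G) is nonempty. If the Chermak–Delgado measure m_G is increasing on P (i.e., for all H, K ∈ P with H ≤ K one has m_G(H) ≤ m_G(K)), then CD(G) ∩ P = {H ∈ P : Z(G) ≤ H}. -/
/-- The center and the whole group have the same Chermak–Delgado measure. -/
theorem cdMeasure_center (G : Type*) [Group G] :
    cdMeasure G (Subgroup.center G) = cdMeasure G ⊤ := by
  have h : Subgroup.centralizer (Subgroup.center G : Set G) = ⊤ :=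
    Subgroup.centralizer_eq_top_iff_subset.2 subset_rfl
  have h' : Subgroup.centralizer ((⊤ : Subgroup G) : Set G) = Subgroup.center G := by
    rw [Subgroup.coe_top, Subgroup.centralizer_univ]
  rw [cdMeasure, cdMeasure, h, h', mul_comm]

/-- Every member of the Chermak–Delgado lattice contains the center. -/
theorem center_le_of_mem_cdLattice {G : Type*} [Group G] [Finite G] {H : Subgroup G}
    (hH : H ∈ cdLattice G) : Subgroup.center G ≤ H := by
  have hle : Subgroup.centralizer (H : Set G) ≤
      Subgroup.centralizer ((H ⊔ Subgroup.center G : Subgroup G) : Set G) := by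
    rw [Subgroup.le_centralizer_iff]
    exact sup_le (Subgroup.le_centralizer_iff.1 le_rfl) (Subgroup.center_le_centralizer _)
  have hcard : Nat.card (H ⊔ Subgroup.center G : Subgroup G) ≤ Nat.card H := by
    refine Nat.le_of_mul_le_mul_right ?_
      (Nat.card_pos (α := Subgroup.centralizer (H : Set G)))
    exact (Nat.mul_le_mul_left _ (Subgroup.card_le_of_le hle)).trans (hH _)
  rw [Subgroup.eq_of_le_of_card_ge le_sup_left hcard]
  exact le_sup_right

theorem cd_lattice_inter_of_increasing (G : Type*) [Group G] [Finite G]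
    (P : Set (Subgroup G))
    (hZ : Subgroup.center G ∈ P) (hG : (⊤ : Subgroup G) ∈ P)
    (hne : (P ∩ cdLattice G).Nonempty)
    (hinc : ∀ H K : Subgroup G, H ∈ P → K ∈ P → H ≤ K →
      cdMeasure G H ≤ cdMeasure G K) :
    cdLattice G ∩ P = {H ∈ P | Subgroup.center G ≤ H} := by
  obtain ⟨M, hMP, hM⟩ := hne
  ext H
  refine ⟨fun h => ⟨h.2, center_le_of_mem_cdLattice h.1⟩, fun h => ⟨fun K => ?_, h.1⟩⟩
  calc cdMeasure G K ≤ cdMeasure G M := hM K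
    _ ≤ cdMeasure G ⊤ := hinc M ⊤ hMP hG le_top
    _ = cdMeasure G (Subgroup.center G) := (cdMeasure_center G).symm
    _ ≤ cdMeasure G H := hinc _ H hZ h.1 h.2
end

section
/- Let G be a finite group. Then G is nilpotent if and only if every centralizer in G is subnormal, i.e., for every subgroup H of G the subgroup C_G(H) is subnormal in G. -/
/-- A subgroup `H` of `G` is subnormal if there is a finite chain
`H = H_0 ⊴ H_1 ⊴ ⋯ ⊴ H_n = G` with each term normal in the next. -/
def IsSubnormal {G : Type*} [Group G] (H : Subgroup G) : Prop :=
  ∃ n : ℕ, ∃ c : Fin (n + 1) → Subgroup G,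
    c 0 = H ∧ c (Fin.last n) = ⊤ ∧
    ∀ i : Fin n, c i.castSucc ≤ c i.succ ∧
      ((c i.castSucc).subgroupOf (c i.succ)).Normal

theorem isSubnormal_iff_subgroup_isSubnormal {G : Type*} [Group G] {H : Subgroup G} :
    IsSubnormal H ↔ H.IsSubnormal := by
  constructor
  · rintro ⟨n, c, rfl, hlast, hc⟩
    suffices ∀ i, (c i).IsSubnormal from this 0
    intro i
    induction i using Fin.reverseInduction with
    | last => simp [hlast]
    | cast i ih => exact .step _ _ (hc i).1 ih (hc i).2
  · intro h
    induction h with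
    | top => exact ⟨0, fun _ ↦ ⊤, rfl, rfl, fun i ↦ i.elim0⟩
    | step H K h_le _ hN ih =>
      obtain ⟨n, c, rfl, hlast, hc⟩ := ih
      refine ⟨n + 1, Fin.cons H c, rfl, by simpa [← Fin.succ_last] using hlast, fun i ↦ ?_⟩
      cases i using Fin.cases with
      | zero => exact ⟨h_le, hN⟩
      | succ i => exact hc i

/-- In a finite nilpotent group every subgroup is subnormal. -/
theorem Subgroup.isSubnormal_of_isNilpotent {G : Type*} [Group G] [Finite G]
    [Group.IsNilpotent G] (H : Subgroup G) : H.IsSubnormal := by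
  induction H using WellFoundedGT.induction with
  | ind H ih =>
    obtain rfl | hH := eq_or_ne H ⊤
    · exact .top
    · have hlt := Group.normalizerCondition_of_isNilpotent (G := G) H hH.lt_top
      exact .step _ _ hlt.le (ih _ hlt) Subgroup.normal_in_normalizer

/-- An element of `p`-power order in a nilpotent normal subgroup of a finite group lies in every
Sylow `p`-subgroup. -/
theorem Sylow.mem_of_mem_normal_isNilpotent {G : Type*} [Group G] [Finite G] {p : ℕ}
    [Fact p.Prime] (P : Sylow p G) {N : Subgroup G} [N.Normal] [Group.IsNilpotent N] {x : G}
    (hxN : x ∈ N) (hx : IsPGroup p (Subgroup.zpowers x)) : x ∈ P := by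
  have hx' : IsPGroup p (Subgroup.zpowers (⟨x, hxN⟩ : N)) := by
    refine (hx.comap_of_injective N.subtype N.subtype_injective).to_le ?_
    simp [Subgroup.mem_subgroupOf]
  obtain ⟨Q, hQ⟩ := hx'.exists_le_sylow
  have hQN : (Q : Subgroup N).Normal :=
    ((Group.isNilpotent_of_finite_tfae (G := N)).out 0 3 :
      Group.IsNilpotent N ↔ ∀ (p : ℕ) (_ : Fact p.Prime) (P : Sylow p N),
        (P : Subgroup N).Normal).mp inferInstance p inferInstance Q
  have := Q.characteristic_of_normal hQN
  exact (Q.isPGroup'.map N.subtype).le_sylow_of_normal P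
    ⟨⟨x, hxN⟩, hQ (Subgroup.mem_zpowers _), rfl⟩

/-- A finite group in which the centralizer of every element is subnormal is nilpotent. -/
theorem Group.isNilpotent_of_isSubnormal_centralizer {G : Type*} [Group G] [Finite G]
    (h : ∀ x : G, (Subgroup.centralizer {x}).IsSubnormal) : Group.IsNilpotent G := by
  induction hn : Nat.card G using Nat.strong_induction_on generalizing G with
  | h n ih =>
    subst hn
    refine ((Group.isNilpotent_of_finite_tfae (G := G)).out 0 3 :
      Group.IsNilpotent G ↔ ∀ (p : ℕ) (_ : Fact p.Prime) (P : Sylow p G),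
        (P : Subgroup G).Normal).mpr fun p _ P ↦ ?_
    have key (x : G) (hx : IsPGroup p (Subgroup.zpowers x)) (Q : Sylow p G) : x ∈ Q := by
      obtain hc | ⟨N, hN, hxN, hNlt⟩ := (h x).lt_normal
      · have hxc : x ∈ Subgroup.center G := by
          simpa [Subgroup.centralizer_eq_top_iff_subset] using hc
        have : Group.IsNilpotent (Subgroup.center G) :=
          ⟨1, Subgroup.upperCentralSeries_one_eq_top_iff.mpr inferInstance⟩
        exact Q.mem_of_mem_normal_isNilpotent hxc hx
      · have : Group.IsNilpotent N := by
          refine ih _ ?_ (fun y ↦ ?_) rfl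
          · exact lt_of_le_of_ne N.card_le_card_group
              fun he ↦ hNlt.ne (Subgroup.eq_top_of_card_eq N he)
          · convert (h (y : G)).subgroupOf (K := N) using 1
            ext z
            simp only [Subgroup.mem_subgroupOf, Subgroup.mem_centralizer_singleton_iff,
              Subtype.ext_iff, Subgroup.coe_mul]
        exact Q.mem_of_mem_normal_isNilpotent
          (hxN (Subgroup.mem_centralizer_singleton_iff.mpr rfl)) hx
    have : Subsingleton (Sylow p G) := by
      refine ⟨fun Q R ↦ Sylow.ext (Q.is_maximal' R.isPGroup' fun x hxQ ↦ key x ?_ R).symm⟩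
      exact Q.isPGroup'.to_le (Subgroup.zpowers_le.mpr hxQ)
    exact P.normal_of_subsingleton

theorem nilpotent_iff_centralizers_subnormal (G : Type*) [Group G] [Finite G] :
    Group.IsNilpotent G ↔
      ∀ H : Subgroup G, IsSubnormal (Subgroup.centralizer (H : Set G)) := by
  simp only [isSubnormal_iff_subgroup_isSubnormal]
  refine ⟨fun _ H ↦ Subgroup.isSubnormal_of_isNilpotent _, fun h ↦
    Group.isNilpotent_of_isSubnormal_centralizer fun x ↦ ?_⟩
  simpa [Subgroup.centralizer_closure] using h (Subgroup.closure {x})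
end

section
/- Let p be a prime and let G be a finite p-group with C(G) = CD(G). Write |G| = p^a and |Z(G)| = p^b. Then a + b is even, and every self-centralizing abelian subgroup A of G (i.e., abelian A with A = C_G(A)) has order p^{(a+b)/2}; equivalently, |A|² = |G|·|Z(G)|. -/
/-- Every finite group has a subgroup that equals its own centralizer. -/
theorem exists_centralizer_eq_self (G : Type*) [Group G] [Finite G] :
    ∃ A : Subgroup G, Subgroup.centralizer (A : Set G) = A := by
  obtain ⟨A, hA⟩ := Set.Finite.exists_maximal
    (Set.toFinite {A : Subgroup G | A ≤ Subgroup.centralizer (A : Set G)}) ⟨⊥, bot_le (α := Subgroup G)⟩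
  refine ⟨A, le_antisymm (fun x hx => ?_) hA.prop⟩
  have hxA : Subgroup.zpowers x ≤ Subgroup.centralizer (A : Set G) := by simpa using hx
  have hxx : Subgroup.zpowers x ≤ Subgroup.centralizer (Subgroup.zpowers x : Set G) := by
    rw [Subgroup.zpowers_le, Subgroup.mem_centralizer_iff]
    rintro _ ⟨n, rfl⟩
    exact ((Commute.refl x).zpow_left n).eq
  have hsup : A ⊔ Subgroup.zpowers x ≤
      Subgroup.centralizer ((A ⊔ Subgroup.zpowers x : Subgroup G) : Set G) :=
    sup_le (Subgroup.le_centralizer_iff.mp (sup_le hA.prop hxA))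
      (Subgroup.le_centralizer_iff.mp (sup_le (Subgroup.le_centralizer_iff.mp hxA) hxx))
  exact hA.le_of_ge hsup le_sup_left
    ((le_sup_right : _ ≤ A ⊔ _) (Subgroup.mem_zpowers x))

/-- If all centralizers have maximal Chermak–Delgado measure, then a subgroup `A` that equals its
own centralizer satisfies `|A|² = |G| * |Z(G)|`. -/
theorem card_sq_of_centralizer_eq_self {G : Type*} [Group G]
    (hCD : centLattice G = cdLattice G) {A : Subgroup G}
    (hA : Subgroup.centralizer (A : Set G) = A) :
    Nat.card A ^ 2 = Nat.card G * Nat.card (Subgroup.center G) := by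
  have hAmem : A ∈ cdLattice G := hCD ▸ ⟨A, hA.symm⟩
  have hTop : (⊤ : Subgroup G) ∈ cdLattice G := hCD ▸
    ⟨⊥, (Subgroup.centralizer_eq_top_iff_subset.mpr (bot_le (α := Subgroup G))).symm⟩
  have h := le_antisymm (hTop A) (hAmem ⊤)
  simpa [cdMeasure, hA, sq, Subgroup.centralizer_univ] using h

theorem self_centralizing_abelian_card (G : Type*) [Group G] [Finite G]
    (p a b : ℕ) (hp : p.Prime)
    (hG : Nat.card G = p ^ a) (hZ : Nat.card (Subgroup.center G) = p ^ b)
    (hCD : centLattice G = cdLattice G) :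
    Even (a + b) ∧
      ∀ A : Subgroup G, (∀ x ∈ A, ∀ y ∈ A, x * y = y * x) →
        Subgroup.centralizer (A : Set G) = A →
        Nat.card A = p ^ ((a + b) / 2) ∧
          Nat.card A ^ 2 = Nat.card G * Nat.card (Subgroup.center G) := by
  have key : ∀ A : Subgroup G, Subgroup.centralizer (A : Set G) = A →
      ∃ n, Nat.card A = p ^ n ∧ a + b = n * 2 := by
    intro A hA
    have hsq := card_sq_of_centralizer_eq_self hCD hA
    obtain ⟨n, -, hn⟩ := (Nat.dvd_prime_pow hp).mp (hG ▸ A.card_subgroup_dvd_card)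
    refine ⟨n, hn, ?_⟩
    rw [hn, hG, hZ, ← pow_mul, ← pow_add] at hsq
    exact (Nat.pow_right_injective hp.two_le hsq).symm
  refine ⟨?_, fun A _ hA => ⟨?_, card_sq_of_centralizer_eq_self hCD hA⟩⟩
  · obtain ⟨A, hA⟩ := exists_centralizer_eq_self G
    obtain ⟨n, -, hn⟩ := key A hA
    exact hn ▸ even_two.mul_left n
  · obtain ⟨n, hn, hab⟩ := key A hA
    rw [hn, hab, Nat.mul_div_cancel _ two_pos]
end

section
/- Let G be a nonabelian finite group. Then G has at least three distinct maximal centralizers (coatoms of C(G)), and at least three distinct minimal centralizers (atoms of C(G), i.e., elements C ∈ C(G) with Z(G) < C such that no D ∈ C(G) satisfies Z(G) < D < C). -/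
namespace Subgroup

variable {G : Type*} [Group G]

theorem centralizer_mem_centLattice (H : Subgroup G) :
    centralizer (H : Set G) ∈ centLattice G :=
  ⟨H, rfl⟩

theorem centralizer_centralizer_of_mem_centLattice {C : Subgroup G} (hC : C ∈ centLattice G) :
    centralizer (centralizer (C : Set G) : Set G) = C := by
  obtain ⟨H, rfl⟩ := hC
  apply le_antisymm
  · exact centralizer_le (le_centralizer_iff.mp le_rfl)
  · exact le_centralizer_iff.mp le_rfl

theorem centralizer_lt_centralizer_of_mem_centLattice {C D : Subgroup G}
    (hC : C ∈ centLattice G) (hD : D ∈ centLattice G) (h : C < D) :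
    centralizer (D : Set G) < centralizer (C : Set G) := by
  refine lt_of_le_of_ne (centralizer_le h.le) fun heq => h.ne ?_
  rw [← centralizer_centralizer_of_mem_centLattice hC, ← heq,
    centralizer_centralizer_of_mem_centLattice hD]

/-- Every noncentral element lies in a maximal centralizer. -/
theorem exists_maximal_centralizer_mem [Finite G] {x : G} (hx : x ∉ center G) :
    ∃ M : Subgroup G, Maximal (fun D => D ∈ centLattice G ∧ D < ⊤) M ∧ x ∈ M := by
  have hlt : centralizer (zpowers x : Set G) < ⊤ := by
    refine lt_top_iff_ne_top.mpr fun h => hx ?_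
    exact centralizer_eq_top_iff_subset.mp h (mem_zpowers x)
  obtain ⟨M, hle, hM⟩ := (Set.toFinite {D : Subgroup G | D ∈ centLattice G ∧ D < ⊤}).exists_le_maximal
    (a := centralizer (zpowers x : Set G)) ⟨centralizer_mem_centLattice _, hlt⟩
  refine ⟨M, hM, hle (mem_centralizer_iff.mpr ?_)⟩
  rintro _ ⟨n, rfl⟩
  exact (Commute.refl x).zpow_left n

theorem center_le_of_mem_centLattice {C : Subgroup G} (hC : C ∈ centLattice G) :
    center G ≤ C := by
  obtain ⟨H, rfl⟩ := hC
  exact center_le_centralizer _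

theorem exists_three_maximal_centralizers [Finite G] (hna : ∃ x y : G, x * y ≠ y * x) :
    ∃ M₁ M₂ M₃ : Subgroup G, M₁ ≠ M₂ ∧ M₁ ≠ M₃ ∧ M₂ ≠ M₃ ∧
      ∀ M ∈ ({M₁, M₂, M₃} : Set (Subgroup G)),
        Maximal (fun D => D ∈ centLattice G ∧ D < ⊤) M := by
  obtain ⟨x, x', hxx'⟩ := hna
  have hx : x ∉ center G := fun h => hxx' (mem_center_iff.mp h x').symm
  obtain ⟨M₁, hM₁, -⟩ := exists_maximal_centralizer_mem hx
  obtain ⟨y, -, hy⟩ := SetLike.exists_of_lt hM₁.prop.2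
  obtain ⟨M₂, hM₂, hyM₂⟩ := exists_maximal_centralizer_mem
    fun h => hy (center_le_of_mem_centLattice hM₁.prop.1 h)
  obtain ⟨z, hz₁, hz₂⟩ : ∃ z ∈ M₁, z ∉ M₂ :=
    SetLike.not_le_iff_exists.mp fun h => hy (hM₁.le_of_ge hM₂.prop h hyM₂)
  have h₁ : y * z ∉ M₁ := fun h => hy ((mul_mem_cancel_right hz₁).mp h)
  have h₂ : y * z ∉ M₂ := fun h => hz₂ ((mul_mem_cancel_left hyM₂).mp h)
  obtain ⟨M₃, hM₃, h₃⟩ := exists_maximal_centralizer_mem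
    fun h => h₁ (center_le_of_mem_centLattice hM₁.prop.1 h)
  refine ⟨M₁, M₂, M₃, ?_, ?_, ?_, ?_⟩
  · rintro rfl; exact hy hyM₂
  · rintro rfl; exact h₁ h₃
  · rintro rfl; exact h₂ h₃
  · rintro M (rfl | rfl | rfl) <;> assumption

end Subgroup

theorem three_maximal_and_minimal_centralizers (G : Type*) [Group G] [Finite G]
    (hna : ∃ x y : G, x * y ≠ y * x) :
    (∃ M₁ M₂ M₃ : Subgroup G, M₁ ≠ M₂ ∧ M₁ ≠ M₃ ∧ M₂ ≠ M₃ ∧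
      (∀ M ∈ ({M₁, M₂, M₃} : Set (Subgroup G)), M ∈ centLattice G ∧ M ≠ ⊤ ∧
        ¬ ∃ D ∈ centLattice G, M < D ∧ D < ⊤)) ∧
    (∃ C₁ C₂ C₃ : Subgroup G, C₁ ≠ C₂ ∧ C₁ ≠ C₃ ∧ C₂ ≠ C₃ ∧
      (∀ C ∈ ({C₁, C₂, C₃} : Set (Subgroup G)), C ∈ centLattice G ∧
        Subgroup.center G < C ∧
        ¬ ∃ D ∈ centLattice G, Subgroup.center G < D ∧ D < C)) := by
  obtain ⟨M₁, M₂, M₃, h₁₂, h₁₃, h₂₃, hM⟩ := Subgroup.exists_three_maximal_centralizers hna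
  have hinj : ∀ M ∈ ({M₁, M₂, M₃} : Set (Subgroup G)), ∀ N ∈ ({M₁, M₂, M₃} : Set (Subgroup G)),
      M ≠ N → Subgroup.centralizer (M : Set G) ≠ Subgroup.centralizer (N : Set G) := by
    intro M hMm N hN hne heq
    apply hne
    rw [← Subgroup.centralizer_centralizer_of_mem_centLattice (hM M hMm).prop.1, heq,
      Subgroup.centralizer_centralizer_of_mem_centLattice (hM N hN).prop.1]
  have htop : (⊤ : Subgroup G) ∈ centLattice G :=
    ⟨⊥, (Subgroup.centralizer_eq_top_iff_subset.mpr (by simp)).symm⟩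
  have hdual : ∀ M ∈ ({M₁, M₂, M₃} : Set (Subgroup G)),
      Subgroup.centralizer (M : Set G) ∈ centLattice G ∧
        Subgroup.center G < Subgroup.centralizer (M : Set G) ∧
        ¬ ∃ D ∈ centLattice G, Subgroup.center G < D ∧
          D < Subgroup.centralizer (M : Set G) := by
    intro M hMm
    have hmax := hM M hMm
    have hcen : Subgroup.centralizer ((⊤ : Subgroup G) : Set G) = Subgroup.center G := by
      rw [Subgroup.coe_top, Subgroup.centralizer_univ]
    have hcenter : Subgroup.center G ∈ centLattice G := ⟨⊤, hcen.symm⟩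
    refine ⟨Subgroup.centralizer_mem_centLattice M, ?_, ?_⟩
    · rw [← hcen]
      exact Subgroup.centralizer_lt_centralizer_of_mem_centLattice hmax.prop.1 htop hmax.prop.2
    · rintro ⟨D, hD, hZD, hDM⟩
      have hlt := Subgroup.centralizer_lt_centralizer_of_mem_centLattice hD
        (Subgroup.centralizer_mem_centLattice M) hDM
      rw [Subgroup.centralizer_centralizer_of_mem_centLattice hmax.prop.1] at hlt
      exact hmax.not_prop_of_gt hlt ⟨Subgroup.centralizer_mem_centLattice D,
        (Subgroup.centralizer_lt_centralizer_of_mem_centLattice hcenter hD hZD).trans_le le_top⟩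
  refine ⟨⟨M₁, M₂, M₃, h₁₂, h₁₃, h₂₃, fun M hMm => ⟨(hM M hMm).prop.1, (hM M hMm).prop.2.ne, ?_⟩⟩,
    Subgroup.centralizer (M₁ : Set G), Subgroup.centralizer (M₂ : Set G),
    Subgroup.centralizer (M₃ : Set G), hinj _ (by simp) _ (by simp) h₁₂,
    hinj _ (by simp) _ (by simp) h₁₃, hinj _ (by simp) _ (by simp) h₂₃, ?_⟩
  · rintro ⟨D, hD, hMD, hDt⟩
    exact (hM M hMm).not_prop_of_gt hMD ⟨hD, hDt⟩
  · rintro C (rfl | rfl | rfl) <;> exact hdual _ (by simp)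
end
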